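/- There exists a set R ⊆ [0,1] of irrational numbers whose complement in [0,1] has Lebesgue measure zero, with the following property: for every minimal orientation-preserving circle homeomorphism f with rotation number ρ=ρ(f)∈R, with unique invariant Borel probability measure μ, and for every x∈S¹, the set B_x of points y∈S¹ for which the sequence (T^n(ρ, 1−μ(A(x,y))))_{n≥0} is dense in [0,1]×[−1,1] contains a residual subset of S¹ and satisfies μ(B_x)=1. Here A(x,y) denotes the positively oriented arc from x to y; the sequence (T^n(ρ,1−μ(A(x,y))))_{n≥0} is precisely the renormalization trail of y with respect to x and f. -/

import Mathlib

noncomputable section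

open Set Filter MeasureTheory Topology

/-- The circle `ℝ/ℤ`. -/
abbrev S1 := AddCircle (1 : ℝ)

/-- `F` is an (orientation-preserving) lift of the circle map `f`. -/
def IsLift (f : S1 → S1) (F : ℝ → ℝ) : Prop :=
  StrictMono F ∧ Function.Surjective F ∧ (∀ x : ℝ, F (x + 1) = F x + 1) ∧
    ∀ x : ℝ, f (x : S1) = (F x : S1)

/-- `f` is an orientation-preserving circle homeomorphism. -/
def IsCircleHomeo (f : S1 → S1) : Prop := ∃ F : ℝ → ℝ, IsLift f F

/-- `f` has rotation number `ρ ∈ [0,1)`: some lift of `f` has translation number `ρ`. -/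
def HasRotNum (f : S1 → S1) (ρ : ℝ) : Prop :=
  ∃ F : ℝ → ℝ, IsLift f F ∧ Tendsto (fun n : ℕ => F^[n] 0 / (n : ℝ)) atTop (𝓝 ρ)

/-- The lift `F` has a non-flat (power-law) critical point at `c`:
on a neighbourhood `W` of `c`, `F y = F c + φ(y)|φ(y)|^(d-1)` for a `C³` diffeomorphism `φ`
with `φ c = 0`. -/
def NonFlatAt (F : ℝ → ℝ) (c : ℝ) : Prop :=
  ∃ d : ℝ, 1 < d ∧ ∃ W : Set ℝ, IsOpen W ∧ c ∈ W ∧ ∃ φ : ℝ → ℝ,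
    ContDiffOn ℝ 3 φ W ∧ InjOn φ W ∧ (∀ y ∈ W, deriv φ y ≠ 0) ∧ φ c = 0 ∧
    ∀ y ∈ W, F y = F c + φ y * |φ y| ^ (d - 1)

/-- `f` is a `C^k` unicritical circle map: an orientation-preserving `C^k` circle
homeomorphism whose only critical point is `c`, and it is non-flat. -/
def Unicritical (f : S1 → S1) (c : S1) (k : ℕ∞) : Prop :=
  ∃ (F : ℝ → ℝ) (x₀ : ℝ), IsLift f F ∧ ContDiff ℝ k F ∧ (x₀ : S1) = c ∧
    {x : ℝ | deriv F x = 0} = {x : ℝ | ∃ m : ℤ, x = x₀ + m} ∧ NonFlatAt F x₀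

/-- `f` is a `C^k` bi-critical circle map: an orientation-preserving `C^k` circle
homeomorphism with exactly two critical points `c₁ ≠ c₂`, both non-flat. -/
def Bicritical (f : S1 → S1) (c₁ c₂ : S1) (k : ℕ∞) : Prop :=
  c₁ ≠ c₂ ∧ ∃ (F : ℝ → ℝ) (x₁ x₂ : ℝ), IsLift f F ∧ ContDiff ℝ k F ∧
    (x₁ : S1) = c₁ ∧ (x₂ : S1) = c₂ ∧
    {x : ℝ | deriv F x = 0} =
      {x : ℝ | ∃ m : ℤ, x = x₁ + m} ∪ {x : ℝ | ∃ m : ℤ, x = x₂ + m} ∧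
    NonFlatAt F x₁ ∧ NonFlatAt F x₂

/-- `h` is a quasisymmetric (orientation-preserving) circle homeomorphism. -/
def QuasiSymm (h : S1 → S1) : Prop :=
  ∃ H : ℝ → ℝ, IsLift h H ∧ ∃ M : ℝ, 1 < M ∧ ∀ x t : ℝ, 0 < t →
    1 / M ≤ (H (x + t) - H x) / (H x - H (x - t)) ∧
      (H (x + t) - H x) / (H x - H (x - t)) ≤ M

/-- The length (in `[0,1)`) of the positively oriented arc from `x` to `y`. -/
def arcLen (x y : S1) : ℝ := (AddCircle.equivIco 1 0 (y - x) : ℝ)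

/-- The positively oriented open arc from `x` to `y` on the circle. -/
def posArc (x y : S1) : Set S1 := (fun t : ℝ => x + (t : S1)) '' Ioo 0 (arcLen x y)

/-- The Gauss map `G(ρ) = {1/ρ}`, `G(0) = 0`. -/
def gaussMap (ρ : ℝ) : ℝ := if ρ = 0 then 0 else Int.fract (1 / ρ)

/-- The fiber maps `T_ρ : [-1,1] → [-1,1]` of the skew product. -/
def fiberMap (ρ α : ℝ) : ℝ :=
  if ρ = 0 then 0
  else if α ≤ 0 then -α
  else if α ≤ ρ * gaussMap ρ then -α / (ρ * gaussMap ρ)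
  else Int.fract ((1 - α) / ρ)

/-- The skew product `T(ρ,α) = (G(ρ), T_ρ(α))`. -/
def skewProd (p : ℝ × ℝ) : ℝ × ℝ := (gaussMap p.1, fiberMap p.1 p.2)

/-- The rectangle `R = [0,1] × [-1,1]`. -/
def Rect : Set (ℝ × ℝ) := Icc (0 : ℝ) 1 ×ˢ Icc (-1 : ℝ) 1

/-- `M = ([0,1] ∖ ℚ) × [-1,1]`. -/
def Mset : Set (ℝ × ℝ) := {p | p ∈ Rect ∧ Irrational p.1}

/-- The `n`-th partial quotient of the continued fraction expansion of `θ`: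
`a_n(θ) = ⌊1 / Gⁿ(θ)⌋`. -/
def pquot (θ : ℝ) (n : ℕ) : ℕ := ⌊1 / gaussMap^[n] θ⌋₊

/-- The set `𝔼_∞` of irrational numbers in `(0,1)` all of whose partial quotients are even
and tend to infinity. -/
def Einf : Set ℝ :=
  {θ | θ ∈ Ioo (0 : ℝ) 1 ∧ Irrational θ ∧ (∀ n, Even (pquot θ n)) ∧
    Tendsto (fun n => pquot θ n) atTop atTop}

/-- A set of reals which near each of its points misses a fixed proportion of arbitrarily small
intervals is Lebesgue null. -/
theorem volume_eq_zero_of_porous {S : Set ℝ} {c : ℝ} (hc : 0 < c)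
    (h : ∀ x ∈ S, ∀ ε > 0, ∃ w δ u v : ℝ, 0 < δ ∧ δ < ε ∧ x ∈ Metric.closedBall w δ ∧
      Ioo u v ⊆ Metric.closedBall w δ ∧ Disjoint S (Ioo u v) ∧ c * (2 * δ) ≤ v - u) :
    volume S = 0 := by
  have key := IsUnifLocDoublingMeasure.ae_tendsto_measure_inter_div.{_, 0}
    (volume : Measure ℝ) S 1
  refine measure_mono_null ?_ (Measure.measure_inter_eq_zero_of_restrict key)
  refine fun x hx => ⟨fun hden => ?_, hx⟩
  choose w δ u v hδ0 hδ hmem hsub hdisj hlen using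
    fun j : ℕ => h x hx (1 / ((j : ℝ) + 1)) Nat.one_div_pos_of_nat
  have hlim : Tendsto δ atTop (𝓝[>] 0) := by
    refine tendsto_nhdsWithin_iff.2 ⟨?_, Eventually.of_forall hδ0⟩
    exact squeeze_zero (fun j => (hδ0 j).le) (fun j => (hδ j).le)
      tendsto_one_div_add_atTop_nhds_zero_nat
  have hone := hden w δ hlim (Eventually.of_forall fun j => by simpa using hmem j)
  have hle : ∀ j, volume (S ∩ Metric.closedBall (w j) (δ j)) /
      volume (Metric.closedBall (w j) (δ j)) ≤ ENNReal.ofReal (1 - c) := by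
    intro j
    have hpos : 0 < 2 * δ j := by linarith [hδ0 j]
    have h1 : S ∩ Metric.closedBall (w j) (δ j) ⊆ Metric.closedBall (w j) (δ j) \ Ioo (u j) (v j) :=
      fun y hy => ⟨hy.2, fun hy' => (Set.disjoint_left.1 (hdisj j)) hy.1 hy'⟩
    have h2 : volume (S ∩ Metric.closedBall (w j) (δ j)) ≤
        ENNReal.ofReal ((1 - c) * (2 * δ j)) := by
      refine (measure_mono h1).trans ?_
      rw [measure_sdiff (hsub j) measurableSet_Ioo.nullMeasurableSet (by simp),
        Real.volume_closedBall, Real.volume_Ioo,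
        ← ENNReal.ofReal_sub _ (by nlinarith [hlen j])]
      exact ENNReal.ofReal_le_ofReal (by linarith [hlen j])
    refine ENNReal.div_le_of_le_mul (h2.trans_eq ?_)
    rw [Real.volume_closedBall, ENNReal.ofReal_mul' hpos.le]
  have hcontra := le_of_tendsto' hone hle
  rw [ENNReal.one_le_ofReal] at hcontra
  linarith

theorem gaussMap_of_irrational {ρ : ℝ} (h : Irrational ρ) : gaussMap ρ = Int.fract (1 / ρ) :=
  if_neg h.ne_zero

theorem gaussMap_mem_Ioo {ρ : ℝ} (h : Irrational ρ) : gaussMap ρ ∈ Ioo (0 : ℝ) 1 := by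
  rw [gaussMap_of_irrational h]
  refine ⟨Int.fract_pos.2 fun he => ?_, Int.fract_lt_one _⟩
  rw [one_div] at he
  exact (irrational_inv_iff.2 h).ne_int _ he

theorem irrational_gaussMap {ρ : ℝ} (h : Irrational ρ) : Irrational (gaussMap ρ) := by
  rw [gaussMap_of_irrational h, Int.fract, one_div]
  exact (irrational_inv_iff.2 h).sub_intCast _

theorem gaussMap_iterate_mem {ρ : ℝ} (h : Irrational ρ) (h01 : ρ ∈ Ioo (0 : ℝ) 1) (n : ℕ) :
    Irrational (gaussMap^[n] ρ) ∧ gaussMap^[n] ρ ∈ Ioo (0 : ℝ) 1 := by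
  induction n with
  | zero => exact ⟨h, h01⟩
  | succ n ih =>
    rw [Function.iterate_succ_apply']
    exact ⟨irrational_gaussMap ih.1, gaussMap_mem_Ioo ih.1⟩

/-- A number of `(0, 1)` is `1 / (a + G ρ)` with a positive integer `a`. -/
theorem exists_eq_one_div_add_gaussMap {ρ : ℝ} (h : Irrational ρ) (h01 : ρ ∈ Ioo (0 : ℝ) 1) :
    ∃ a : ℤ, 1 ≤ a ∧ ρ * (a + gaussMap ρ) = 1 := by
  refine ⟨⌊1 / ρ⌋, Int.le_floor.2 ?_, ?_⟩
  · rw [Int.cast_one, le_div_iff₀ h01.1]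
    linarith [h01.2]
  · rw [gaussMap_of_irrational h, Int.floor_add_fract, mul_one_div_cancel h.ne_zero]

theorem gaussMap_one_div_int_add {a : ℤ} (ha : 1 ≤ a) {s : ℝ} (hs : s ∈ Ioo (0 : ℝ) 1) :
    gaussMap (1 / (a + s)) = s := by
  have ha' : (1 : ℝ) ≤ a := by exact_mod_cast ha
  have h0 : (0 : ℝ) < a + s := by linarith [hs.1]
  rw [gaussMap, if_neg (by positivity), one_div_one_div, Int.fract_intCast_add,
    Int.fract_eq_self.2 ⟨hs.1.le, hs.2⟩]

/-- The inverse branch of the `n`-th iterate of the Gauss map through an irrational point is a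
Möbius map of determinant `± 1`. -/
theorem exists_gaussMap_inverse_branch {ρ : ℝ} (h : Irrational ρ) (h01 : ρ ∈ Ioo (0 : ℝ) 1)
    (n : ℕ) : ∃ p p' q q' : ℝ, 0 ≤ q' ∧ q' ≤ q ∧ 1 ≤ q ∧ (n : ℝ) + 1 ≤ q + q' ∧
      |p' * q - p * q'| = 1 ∧
      ρ = (p + p' * gaussMap^[n] ρ) / (q + q' * gaussMap^[n] ρ) ∧
      ∀ t ∈ Ioo (0 : ℝ) 1, gaussMap^[n] ((p + p' * t) / (q + q' * t)) = t := by
  induction n with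
  | zero => exact ⟨0, 1, 1, 0, by simp⟩
  | succ n ih =>
    obtain ⟨p, p', q, q', hq', hqq, hq, hn, hdet, hρ, hbr⟩ := ih
    obtain ⟨hirr, hmem⟩ := gaussMap_iterate_mem h h01 n
    obtain ⟨a, ha, hag⟩ := exists_eq_one_div_add_gaussMap hirr hmem
    have ha' : (1 : ℝ) ≤ a := by exact_mod_cast ha
    have hmob : ∀ s ∈ Ioo (0 : ℝ) 1, (p * a + p' + p * s) / (q * a + q' + q * s) =
        (p + p' * (1 / (a + s))) / (q + q' * (1 / (a + s))) := by
      intro s hs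
      have h0 : (0 : ℝ) < a + s := by linarith [hs.1]
      have h1 : 0 < q * a + q' + q * s := by nlinarith [hs.1]
      have h2 : 0 < q + q' * (1 / (a + s)) := by positivity
      rw [div_eq_div_iff h1.ne' h2.ne']
      field_simp
      ring
    have hone : ∀ s ∈ Ioo (0 : ℝ) 1, 1 / (a + s) ∈ Ioo (0 : ℝ) 1 := by
      intro s hs
      have h0 : (1 : ℝ) < a + s := by linarith [hs.1]
      exact ⟨by positivity, (div_lt_one (by positivity)).2 h0⟩
    refine ⟨p * a + p', p, q * a + q', q, by linarith, by nlinarith, by nlinarith, ?_, ?_, ?_, ?_⟩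
    · push_cast
      nlinarith
    · rw [← hdet, ← abs_neg]
      congr 1
      ring
    · rw [Function.iterate_succ_apply', hmob _ (gaussMap_mem_Ioo hirr)]
      rw [← eq_one_div_of_mul_eq_one_left hag]
      exact hρ
    · intro s hs
      rw [hmob s hs, Function.iterate_succ_apply', hbr _ (hone s hs), gaussMap_one_div_int_add ha hs]

/-- For each open interval `(s, t)` of `(0, 1)`, the irrationals whose Gauss orbit avoids `(s, t)`
from some time on are Lebesgue null. -/
theorem volume_gaussMap_avoid {s t : ℝ} (hs : 0 ≤ s) (hst : s < t) (ht : t ≤ 1) (N : ℕ) :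
    volume {ρ : ℝ | Irrational ρ ∧ ρ ∈ Ioo (0 : ℝ) 1 ∧
      ∀ n ≥ N, gaussMap^[n] ρ ∉ Ioo s t} = 0 := by
  refine volume_eq_zero_of_porous (c := (t - s) / 2) (by linarith) ?_
  rintro ρ ⟨hirr, h01, havoid⟩ ε hε
  obtain ⟨n₀, hn₀⟩ := exists_nat_one_div_lt hε
  set n := max N n₀
  obtain ⟨p, p', q, q', hq', hqq, hq, hn, hdet, hρ, hbr⟩ :=
    exists_gaussMap_inverse_branch hirr h01 n
  have hn0 : 0 < (n₀ : ℝ) + 1 := by positivity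
  have hnn : (n₀ : ℝ) + 1 ≤ q + q' := by
    have : (n₀ : ℝ) ≤ n := by exact_mod_cast le_max_right N n₀
    linarith
  set ψ : ℝ → ℝ := fun x => (p + p' * x) / (q + q' * x) with hψ
  have hden : ∀ x, 0 ≤ x → 0 < q + q' * x := fun x hx => by positivity
  have hdiff : ∀ x y, 0 ≤ x → 0 ≤ y →
      ψ y - ψ x = (p' * q - p * q') * ((y - x) / ((q + q' * x) * (q + q' * y))) := by
    intro x y hx hy
    have hx' := (hden x hx).ne'
    have hy' := (hden y hy).ne'
    simp only [hψ]
    field_simp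
    ring
  have habs : ∀ x y, 0 ≤ x → x ≤ y →
      |ψ y - ψ x| = (y - x) / ((q + q' * x) * (q + q' * y)) := by
    intro x y hx hxy
    have hy := hx.trans hxy
    have h1 : 0 ≤ (y - x) / ((q + q' * x) * (q + q' * y)) :=
      div_nonneg (by linarith) (mul_pos (hden x hx) (hden y hy)).le
    rw [hdiff x y hx hy, abs_mul, hdet, one_mul, abs_of_nonneg h1]
  have hball : ∀ x ∈ Icc (0 : ℝ) 1,
      ψ x ∈ Metric.closedBall ((ψ 0 + ψ 1) / 2) (|ψ 1 - ψ 0| / 2) := by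
    intro x hx
    have h1 : 0 ≤ (x - 0) / ((q + q' * 0) * (q + q' * x)) :=
      div_nonneg (by linarith [hx.1]) (mul_pos (hden 0 le_rfl) (hden x hx.1)).le
    have h2 : 0 ≤ (1 - x) / ((q + q' * x) * (q + q' * 1)) :=
      div_nonneg (by linarith [hx.2]) (mul_pos (hden x hx.1) (hden 1 zero_le_one)).le
    have e1 := hdiff 0 x le_rfl hx.1
    have e2 := hdiff x 1 hx.1 zero_le_one
    rw [Metric.mem_closedBall, Real.dist_eq]
    rcases (abs_eq zero_le_one).1 hdet with hD | hD <;> rw [hD] at e1 e2 <;>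
      cases abs_cases (ψ 1 - ψ 0) <;> cases abs_cases (ψ x - (ψ 0 + ψ 1) / 2) <;> linarith
  have hlen01 : |ψ 1 - ψ 0| = 1 / (q * (q + q')) := by
    rw [habs 0 1 le_rfl zero_le_one]
    simp
  have hcont : ContinuousOn ψ (uIcc s t) := by
    rw [uIcc_of_le hst.le]
    refine ContinuousOn.div (by fun_prop) (by fun_prop) fun x hx => (hden x (hs.trans hx.1)).ne'
  have hhole : ∀ y ∈ Ioo (min (ψ s) (ψ t)) (max (ψ s) (ψ t)), ∃ x ∈ Ioo s t, ψ x = y := by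
    intro y hy
    obtain ⟨x, hx, rfl⟩ := intermediate_value_uIcc hcont ⟨hy.1.le, hy.2.le⟩
    rw [uIcc_of_le hst.le] at hx
    refine ⟨x, ⟨hx.1.lt_of_ne ?_, hx.2.lt_of_ne ?_⟩, rfl⟩
    · rintro rfl
      rcases le_total (ψ s) (ψ t) with hle | hle <;> simp [hle] at hy
    · rintro rfl
      rcases le_total (ψ s) (ψ x) with hle | hle <;> simp [hle] at hy
  have hqpos : 0 < q * (q + q') := by positivity
  refine ⟨(ψ 0 + ψ 1) / 2, |ψ 1 - ψ 0| / 2, min (ψ s) (ψ t), max (ψ s) (ψ t),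
    ?_, ?_, ?_, ?_, ?_, ?_⟩
  · rw [hlen01]
    positivity
  · rw [hlen01]
    have h1 : 1 / (q * (q + q')) ≤ 1 / ((n₀ : ℝ) + 1) :=
      one_div_le_one_div_of_le hn0 (by nlinarith)
    have h2 : 0 < 1 / (q * (q + q')) := by positivity
    linarith
  · rw [hρ]
    exact hball _ (Ioo_subset_Icc_self (gaussMap_iterate_mem hirr h01 n).2)
  · intro y hy
    obtain ⟨x, hx, rfl⟩ := hhole y hy
    exact hball x ⟨hs.trans hx.1.le, hx.2.le.trans ht⟩
  · rw [Set.disjoint_left]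
    rintro y ⟨-, -, hy⟩ hy'
    obtain ⟨x, hx, rfl⟩ := hhole y hy'
    refine hy n (le_max_left _ _) ?_
    rw [hbr x ⟨hs.trans_lt hx.1, hx.2.trans_le ht⟩]
    exact hx
  · rw [max_sub_min_eq_abs, habs s t hs hst.le, hlen01]
    have hs1 := hden s hs
    have ht1 := hden t (hs.trans hst.le)
    have h1 : (q + q' * s) * (q + q' * t) ≤ (q + q') * (2 * q) :=
      mul_le_mul (by nlinarith) (by nlinarith) ht1.le (by positivity)
    calc (t - s) / 2 * (2 * (1 / (q * (q + q')) / 2)) = (t - s) / ((q + q') * (2 * q)) := by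
          field_simp
      _ ≤ _ := div_le_div_of_nonneg_left (by linarith) (by positivity) h1

/-- The irrationals of `(0, 1)` whose Gauss orbit visits every subinterval infinitely often. -/
def gaussRecurrent : Set ℝ :=
  {ρ | Irrational ρ ∧ ρ ∈ Ioo (0 : ℝ) 1 ∧ ∀ s t : ℚ, 0 ≤ (s : ℝ) → s < t → (t : ℝ) ≤ 1 →
    ∀ N : ℕ, ∃ n ≥ N, gaussMap^[n] ρ ∈ Ioo (s : ℝ) t}

theorem volume_diff_gaussRecurrent : volume (Icc (0 : ℝ) 1 \ gaussRecurrent) = 0 := by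
  have hrat : volume (range ((↑) : ℚ → ℝ)) = 0 := (countable_range _).measure_zero _
  have hav : volume (⋃ (s : ℚ) (t : ℚ) (N : ℕ) (_ : 0 ≤ (s : ℝ) ∧ s < t ∧ (t : ℝ) ≤ 1),
      {ρ : ℝ | Irrational ρ ∧ ρ ∈ Ioo (0 : ℝ) 1 ∧ ∀ n ≥ N, gaussMap^[n] ρ ∉ Ioo (s : ℝ) t}) = 0 := by
    simp only [measure_iUnion_null_iff]
    rintro s t N ⟨h1, h2, h3⟩
    exact volume_gaussMap_avoid h1 (by exact_mod_cast h2) h3 N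
  refine measure_mono_null ?_ (measure_union_null hrat hav)
  rintro ρ ⟨h01, hρ⟩
  by_cases hirr : Irrational ρ
  · right
    have h01' : ρ ∈ Ioo (0 : ℝ) 1 :=
      ⟨h01.1.lt_of_ne hirr.ne_zero.symm, h01.2.lt_of_ne hirr.ne_one⟩
    by_contra hnot
    refine hρ ⟨hirr, h01', fun s t hs hst ht N => ?_⟩
    by_contra! hN
    exact hnot (by simp only [mem_iUnion]; exact ⟨s, t, N, ⟨hs, hst, ht⟩, hirr, h01', hN⟩)
  · left
    simpa [Irrational] using hirr

theorem skewProd_iterate_fst (n : ℕ) (p : ℝ × ℝ) : (skewProd^[n] p).1 = gaussMap^[n] p.1 := by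
  induction n with
  | zero => rfl
  | succ n ih => rw [Function.iterate_succ_apply', Function.iterate_succ_apply', ← ih]; rfl

theorem fiberMap_of_neg {ρ α : ℝ} (hρ : ρ ≠ 0) (hα : α < 0) : fiberMap ρ α = -α := by
  rw [fiberMap, if_neg hρ, if_pos hα.le]

theorem fiberMap_of_le {ρ α : ℝ} (hρ : ρ ≠ 0) (hα : 0 < α) (h : α ≤ ρ * gaussMap ρ) :
    fiberMap ρ α = -α / (ρ * gaussMap ρ) := by
  rw [fiberMap, if_neg hρ, if_neg hα.not_ge, if_pos h]

theorem fiberMap_of_gt {ρ α : ℝ} (hρ : ρ ≠ 0) (hα : 0 < α) (h : ρ * gaussMap ρ < α) :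
    fiberMap ρ α = Int.fract ((1 - α) / ρ) := by
  rw [fiberMap, if_neg hρ, if_neg hα.not_ge, if_neg h.not_ge]

theorem countable_preimage_fiberMap {ρ : ℝ} (hρ : Irrational ρ) {C : Set ℝ} (hC : C.Countable) :
    (fiberMap ρ ⁻¹' C).Countable := by
  have hg := (gaussMap_mem_Ioo hρ).1.ne'
  have hsub : fiberMap ρ ⁻¹' C ⊆ ⋃ c ∈ C, ({-c, -(c * (ρ * gaussMap ρ))} ∪
      range fun k : ℤ => 1 - ρ * (c + k)) := by
    intro α hα
    simp only [mem_iUnion]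
    refine ⟨fiberMap ρ α, hα, ?_⟩
    rw [fiberMap, if_neg hρ.ne_zero]
    split_ifs with h1 h2
    · simp
    · left; right
      rw [div_mul_cancel₀ _ (mul_ne_zero hρ.ne_zero hg), neg_neg]
      rfl
    · right
      refine ⟨⌊(1 - α) / ρ⌋, ?_⟩
      simp only [Int.fract_add_floor, mul_div_cancel₀ _ hρ.ne_zero, sub_sub_cancel]
  refine Countable.mono hsub (hC.biUnion fun c _ => ?_)
  exact ((countable_singleton _).insert _).union (countable_range _)

/-- Points of the fiber over `ρ` whose orbit meets the boundary of the Markov cells. -/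
def singularFiber (ρ : ℝ) : Set ℝ :=
  {α | ∃ n : ℕ, (skewProd^[n] (ρ, α)).2 = 0 ∨ (skewProd^[n] (ρ, α)).2 = -1}

theorem countable_singularFiber {ρ : ℝ} (hρ : Irrational ρ) : (singularFiber ρ).Countable := by
  have key : ∀ n : ℕ, ∀ ρ : ℝ, Irrational ρ →
      {α | (skewProd^[n] (ρ, α)).2 ∈ ({0, -1} : Set ℝ)}.Countable := by
    intro n
    induction n with
    | zero => exact fun ρ _ => (countable_singleton _).insert _
    | succ n ih =>
      intro ρ hρ
      exact countable_preimage_fiberMap hρ (ih _ (irrational_gaussMap hρ))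
  have heq : singularFiber ρ = ⋃ n : ℕ, {α | (skewProd^[n] (ρ, α)).2 ∈ ({0, -1} : Set ℝ)} := by
    ext α
    simp [singularFiber]
  rw [heq]
  exact countable_iUnion fun n => key n ρ hρ

/-- The product `ρ G(ρ) ⋯ Gⁿ⁻¹(ρ)`. -/
def gaussProd (ρ : ℝ) (n : ℕ) : ℝ := ∏ i ∈ Finset.range n, gaussMap^[i] ρ

theorem gaussProd_succ (ρ : ℝ) (n : ℕ) :
    gaussProd ρ (n + 1) = gaussProd ρ n * gaussMap^[n] ρ :=
  Finset.prod_range_succ _ _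

theorem gaussProd_pos {ρ : ℝ} (h : Irrational ρ) (h01 : ρ ∈ Ioo (0 : ℝ) 1) (n : ℕ) :
    0 < gaussProd ρ n :=
  Finset.prod_pos fun i _ => (gaussMap_iterate_mem h h01 i).2.1

theorem mul_gaussMap_le_half {ρ : ℝ} (h : Irrational ρ) (h01 : ρ ∈ Ioo (0 : ℝ) 1) :
    ρ * gaussMap ρ ≤ 1 / 2 := by
  obtain ⟨a, ha, hag⟩ := exists_eq_one_div_add_gaussMap h h01
  have ha' : (1 : ℝ) ≤ a := by exact_mod_cast ha
  nlinarith [h01.1, (gaussMap_mem_Ioo h).2]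

theorem gaussProd_le {ρ : ℝ} (h : Irrational ρ) (h01 : ρ ∈ Ioo (0 : ℝ) 1) (n : ℕ) :
    gaussProd ρ n ≤ 4 / 3 * (3 / 4) ^ n := by
  induction n using Nat.twoStepInduction with
  | zero => norm_num [gaussProd]
  | one => norm_num [gaussProd, h01.2.le]
  | more n ih _ =>
    obtain ⟨hirr, hmem⟩ := gaussMap_iterate_mem h h01 n
    rw [gaussProd_succ, gaussProd_succ, mul_assoc, Function.iterate_succ_apply', pow_add]
    calc _ ≤ gaussProd ρ n * (1 / 2) :=
          mul_le_mul_of_nonneg_left (mul_gaussMap_le_half hirr hmem) (gaussProd_pos h h01 n).le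
      _ ≤ _ := by linarith [gaussProd_pos h h01 n]

/-- The inverse branch of the `n`-th fiber iterate through a nonsingular point is affine and is
defined on the whole Markov cell, `(0, 1)` or `(-1, 0)`. -/
theorem exists_fiber_inverse_branch {ρ α : ℝ} (h : Irrational ρ) (h01 : ρ ∈ Ioo (0 : ℝ) 1)
    (hα : α ∈ Ioo (0 : ℝ) 1) (hns : α ∉ singularFiber ρ) (n : ℕ) :
    ∃ a b e : ℝ, (e = 0 ∧ |a| = gaussProd ρ n ∨ e = -1 ∧ |a| = gaussProd ρ (n + 1)) ∧
      (skewProd^[n] (ρ, α)).2 ∈ Ioo e (e + 1) ∧ α = a * (skewProd^[n] (ρ, α)).2 + b ∧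
      ∀ β ∈ Ioo e (e + 1), a * β + b ∈ Ioo (0 : ℝ) 1 ∧
        skewProd^[n] (ρ, a * β + b) = (gaussMap^[n] ρ, β) := by
  have hns' : ∀ n, (skewProd^[n] (ρ, α)).2 ≠ 0 ∧ (skewProd^[n] (ρ, α)).2 ≠ -1 := fun n =>
    ⟨fun h0 => hns ⟨n, Or.inl h0⟩, fun h1 => hns ⟨n, Or.inr h1⟩⟩
  induction n with
  | zero =>
    refine ⟨1, 0, 0, ?_, ?_, ?_, ?_⟩
    · simp [gaussProd]
    · simpa using hα
    · simp
    · simp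
  | succ n ih =>
    obtain ⟨a, b, e, he, hmem, hab, hbr⟩ := ih
    obtain ⟨hirr, hg01⟩ := gaussMap_iterate_mem h h01 n
    have hg' := gaussMap_mem_Ioo hirr
    have hsucc : (skewProd^[n + 1] (ρ, α)).2 =
        fiberMap (gaussMap^[n] ρ) (skewProd^[n] (ρ, α)).2 := by
      rw [Function.iterate_succ_apply', ← skewProd_iterate_fst n (ρ, α)]; rfl
    -- composing with an inverse branch of one step
    have compose : ∀ a' b' e' : ℝ,
        (e' = 0 ∧ |a| * |a'| = gaussProd ρ (n + 1) ∨
          e' = -1 ∧ |a| * |a'| = gaussProd ρ (n + 1 + 1)) →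
        (skewProd^[n + 1] (ρ, α)).2 ∈ Ioo e' (e' + 1) →
        (skewProd^[n] (ρ, α)).2 = a' * (skewProd^[n + 1] (ρ, α)).2 + b' →
        (∀ β ∈ Ioo e' (e' + 1), a' * β + b' ∈ Ioo e (e + 1) ∧
          fiberMap (gaussMap^[n] ρ) (a' * β + b') = β) →
        ∃ a b e : ℝ, (e = 0 ∧ |a| = gaussProd ρ (n + 1) ∨
            e = -1 ∧ |a| = gaussProd ρ (n + 1 + 1)) ∧
          (skewProd^[n + 1] (ρ, α)).2 ∈ Ioo e (e + 1) ∧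
          α = a * (skewProd^[n + 1] (ρ, α)).2 + b ∧
          ∀ β ∈ Ioo e (e + 1), a * β + b ∈ Ioo (0 : ℝ) 1 ∧
            skewProd^[n + 1] (ρ, a * β + b) = (gaussMap^[n + 1] ρ, β) := by
      intro a' b' e' h1 h2 h3 h4
      refine ⟨a * a', a * b' + b, e', by rwa [abs_mul], h2, ?_, fun β hβ => ?_⟩
      · rw [mul_assoc, ← add_assoc, ← mul_add, ← h3]
        exact hab
      · obtain ⟨h5, h6⟩ := h4 β hβ
        obtain ⟨h7, h8⟩ := hbr _ h5
        have h9 : a * a' * β + (a * b' + b) = a * (a' * β + b') + b := by ring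
        refine ⟨h9 ▸ h7, ?_⟩
        rw [h9, Function.iterate_succ_apply', Function.iterate_succ_apply', h8, skewProd, h6]
    have hne := hns' (n + 1)
    set x := (skewProd^[n] (ρ, α)).2
    set y := (skewProd^[n + 1] (ρ, α)).2
    set r := gaussMap^[n] ρ with hr
    set g := gaussMap r with hg
    have hgr : gaussMap^[n + 1] ρ = g := Function.iterate_succ_apply' _ _ _
    have hrg : 0 < r * g := mul_pos hg01.1 hg'.1
    have hr0 := hirr.ne_zero
    have hg0 := hg'.1.ne'
    rcases he with ⟨rfl, ha⟩ | ⟨rfl, ha⟩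
    · rw [zero_add] at *
      rcases le_or_gt x (r * g) with hx | hx
      · have hy : y = -x / (r * g) := by rw [hsucc, fiberMap_of_le hr0 hmem.1 hx]
        have hyx : x = -(r * g) * y := by rw [hy]; field_simp
        refine compose (-(r * g)) 0 (-1) (Or.inr ⟨rfl, ?_⟩) ⟨?_, ?_⟩ (by rw [add_zero]; exact hyx) ?_
        · rw [abs_neg, abs_of_pos hrg, ha, gaussProd_succ, gaussProd_succ, hgr, ← hr]
          ring
        · refine lt_of_le_of_ne ?_ (Ne.symm hne.2)
          by_contra! hlt
          nlinarith
        · by_contra! hlt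
          nlinarith [hmem.1]
        · intro β hβ
          have h1 : 0 < -(r * g) * β + 0 := by nlinarith [hβ.2]
          have h2 : -(r * g) * β + 0 < r * g := by nlinarith [hβ.1]
          have h3 : r * g < 1 := by linarith [mul_gaussMap_le_half hirr hg01]
          refine ⟨⟨h1, by linarith⟩, ?_⟩
          rw [fiberMap_of_le hr0 h1 h2.le, ← hg]
          field_simp
          simp
      · have hy : y = Int.fract ((1 - x) / r) := by rw [hsucc, fiberMap_of_gt hr0 hmem.1 hx]
        obtain ⟨k, hk⟩ : ∃ k : ℤ, ⌊(1 - x) / r⌋ = k := ⟨_, rfl⟩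
        have hky : (1 - x) / r = k + y := by rw [hy, ← hk, Int.floor_add_fract]
        have hyx : x = -r * y + (1 - r * k) := by
          rw [div_eq_iff hr0] at hky
          linarith
        have hy0 : 0 < y := lt_of_le_of_ne (hy ▸ Int.fract_nonneg _) hne.1.symm
        have hy1 : y < 1 := hy ▸ Int.fract_lt_one _
        obtain ⟨m, hm1, hm⟩ := exists_eq_one_div_add_gaussMap hirr hg01
        have hk0 : 0 ≤ k := by
          rw [← hk]
          exact Int.floor_nonneg.2 (div_nonneg (by linarith [hmem.2]) hg01.1.le)
        have hkm : k + 1 ≤ m := by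
          rw [Int.add_one_le_iff]
          have : (k : ℝ) < m := by
            by_contra! hle
            nlinarith [hg01.1]
          exact_mod_cast this
        have hk0' : (0 : ℝ) ≤ k := by exact_mod_cast hk0
        have hkm' : (k : ℝ) + 1 ≤ m := by exact_mod_cast hkm
        refine compose (-r) (1 - r * k) 0 (Or.inl ⟨rfl, ?_⟩) ⟨hy0, by linarith⟩ hyx ?_
        · rw [abs_neg, abs_of_pos hg01.1, ha, gaussProd_succ]
        · intro β hβ
          rw [zero_add] at hβ
          have h1 : r * g < -r * β + (1 - r * k) := by nlinarith [hg01.1, hβ.2]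
          have h2 : -r * β + (1 - r * k) < 1 := by nlinarith [hg01.1, hβ.1]
          refine ⟨⟨hrg.trans h1, h2⟩, ?_⟩
          rw [fiberMap_of_gt hr0 (hrg.trans h1) h1]
          have h3 : (1 - (-r * β + (1 - r * k))) / r = k + β := by field_simp; ring
          rw [h3, Int.fract_intCast_add, Int.fract_eq_self.2 ⟨hβ.1.le, hβ.2⟩]
    · rw [neg_add_cancel] at *
      have hy : y = -x := by rw [hsucc, fiberMap_of_neg hr0 hmem.2]
      refine compose (-1) 0 0 (Or.inl ⟨rfl, ?_⟩) ⟨?_, ?_⟩ (by rw [hy]; ring) ?_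
      · simp [ha]
      · linarith [hmem.2]
      · linarith [hmem.1]
      · intro β hβ
        rw [zero_add] at hβ
        refine ⟨⟨by linarith [hβ.2], by linarith [hβ.1]⟩, ?_⟩
        rw [fiberMap_of_neg hr0 (by linarith [hβ.1])]
        ring

theorem gaussMap_of_half_lt {ρ : ℝ} (h : ρ ∈ Ioo (1 / 2 : ℝ) 1) : gaussMap ρ = 1 / ρ - 1 := by
  have h0 : 0 < ρ := by linarith [h.1]
  have h1 : 1 / ρ - 1 ∈ Ioo (0 : ℝ) 1 :=
    ⟨sub_pos.2 ((one_lt_div h0).2 h.2), by rw [sub_lt_iff_lt_add, div_lt_iff₀ h0]; linarith [h.1]⟩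
  have h2 := gaussMap_one_div_int_add (a := 1) le_rfl h1
  rwa [Int.cast_one, add_sub_cancel, one_div_one_div] at h2

theorem mul_gaussMap_of_half_lt {ρ : ℝ} (h : ρ ∈ Ioo (1 / 2 : ℝ) 1) :
    ρ * gaussMap ρ = 1 - ρ := by
  have h0 : ρ ≠ 0 := by linarith [h.1]
  rw [gaussMap_of_half_lt h]
  field_simp

theorem one_div_one_add_mem {r : ℝ} (hr : r ∈ Ioo (0 : ℝ) 1) :
    1 / (1 + r) ∈ Ioo (1 / 2 : ℝ) 1 := by
  have h0 : 0 < 1 + r := by linarith [hr.1]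
  exact ⟨one_div_lt_one_div_of_lt h0 (by linarith [hr.2]), (div_lt_one h0).2 (by linarith [hr.1])⟩

/-- A neighborhood of a point in the lower half of the rectangle is entered in one step from a
neighborhood of a point in the upper half. -/
theorem exists_skewProd_mem_of_neg {U : Set (ℝ × ℝ)} {r z : ℝ} (hU : U ∈ 𝓝 (r, z))
    (hr : r ∈ Ioo (0 : ℝ) 1) (hz : z ∈ Ioo (-1 : ℝ) 0) :
    ∃ r' ∈ Ioo (0 : ℝ) 1, ∃ z' ∈ Ioo (0 : ℝ) 1, skewProd ⁻¹' U ∈ 𝓝 (r', z') := by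
  set ρ := 1 / (1 + r) with hρ
  have hmem := one_div_one_add_mem hr
  rw [← hρ] at hmem
  have hρr : 1 / ρ - 1 = r := by rw [hρ, one_div_one_div]; ring
  have h1ρ : 0 < 1 - ρ := by linarith [hmem.2]
  have hα : (1 - ρ) * (-z) ∈ Ioo (0 : ℝ) (1 - ρ) :=
    ⟨by nlinarith [hz.2], by nlinarith [hz.1]⟩
  refine ⟨ρ, ⟨by linarith [hmem.1], hmem.2⟩, (1 - ρ) * (-z), ⟨hα.1, by linarith [hα.2, hmem.1]⟩, ?_⟩
  have hcont : ContinuousAt (fun p : ℝ × ℝ => (1 / p.1 - 1, -p.2 / (1 - p.1)))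
      (ρ, (1 - ρ) * (-z)) := by
    have h2 : (ρ, (1 - ρ) * (-z)).1 ≠ 0 := by simp only; linarith [hmem.1]
    have h3 : 1 - (ρ, (1 - ρ) * (-z)).1 ≠ 0 := h1ρ.ne'
    fun_prop (disch := assumption)
  have hval : (1 / ρ - 1, -((1 - ρ) * (-z)) / (1 - ρ)) = (r, z) := by
    rw [hρr]; congr 1; field_simp
  have hpre := hcont.preimage_mem_nhds (t := U) (by simpa only [hval] using hU)
  have h1 : ∀ᶠ p : ℝ × ℝ in 𝓝 (ρ, (1 - ρ) * (-z)), p.1 ∈ Ioo (1 / 2 : ℝ) 1 :=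
    continuousAt_fst.eventually_mem (isOpen_Ioo.mem_nhds hmem)
  have h2 : ∀ᶠ p : ℝ × ℝ in 𝓝 (ρ, (1 - ρ) * (-z)), 0 < p.2 :=
    continuousAt_snd.eventually_const_lt hα.1
  have h3 : ∀ᶠ p : ℝ × ℝ in 𝓝 (ρ, (1 - ρ) * (-z)), p.2 < 1 - p.1 :=
    ContinuousAt.eventually_lt (by fun_prop) (by fun_prop) hα.2
  filter_upwards [hpre, h1, h2, h3] with p hp hp1 hp2 hp3
  have h4 := mul_gaussMap_of_half_lt hp1
  rw [mem_preimage, skewProd, fiberMap_of_le (by linarith [hp1.1]) hp2 (by linarith), h4,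
    gaussMap_of_half_lt hp1]
  exact hp

/-- A neighborhood of a point in the upper half of the rectangle is entered in one step from
neighborhoods of points of a common fiber in both halves. -/
theorem exists_skewProd_mem_of_pos {U : Set (ℝ × ℝ)} {r z : ℝ} (hU : U ∈ 𝓝 (r, z))
    (hr : r ∈ Ioo (0 : ℝ) 1) (hz : z ∈ Ioo (0 : ℝ) 1) :
    ∃ r' ∈ Ioo (0 : ℝ) 1, ∃ z₁ ∈ Ioo (0 : ℝ) 1, ∃ z₂ ∈ Ioo (-1 : ℝ) 0,
      skewProd ⁻¹' U ∈ 𝓝 (r', z₁) ∧ skewProd ⁻¹' U ∈ 𝓝 (r', z₂) := by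
  set ρ := 1 / (1 + r) with hρ
  have hmem := one_div_one_add_mem hr
  rw [← hρ] at hmem
  have hρr : 1 / ρ - 1 = r := by rw [hρ, one_div_one_div]; ring
  have hρ0 : 0 < ρ := by linarith [hmem.1]
  have hev : ∀ w : ℝ, ∀ᶠ p : ℝ × ℝ in 𝓝 (ρ, w), p.1 ∈ Ioo (1 / 2 : ℝ) 1 := fun w =>
    continuousAt_fst.eventually_mem (isOpen_Ioo.mem_nhds hmem)
  refine ⟨ρ, ⟨hρ0, hmem.2⟩, 1 - ρ * z, ⟨by nlinarith [hz.2, hmem.2], by nlinarith [hz.1]⟩,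
    -z, ⟨by linarith [hz.2], by linarith [hz.1]⟩, ?_, ?_⟩
  · have hcont : ContinuousAt (fun p : ℝ × ℝ => (1 / p.1 - 1, (1 - p.2) / p.1))
        (ρ, 1 - ρ * z) := by
      have h2 : (ρ, 1 - ρ * z).1 ≠ 0 := hρ0.ne'
      fun_prop (disch := assumption)
    have hval : (1 / ρ - 1, (1 - (1 - ρ * z)) / ρ) = (r, z) := by
      rw [hρr]; congr 1; field_simp; ring
    have hpre := hcont.preimage_mem_nhds (t := U) (by simpa only [hval] using hU)
    have h2 : ∀ᶠ p : ℝ × ℝ in 𝓝 (ρ, 1 - ρ * z), p.2 < 1 :=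
      continuousAt_snd.eventually_lt_const (by nlinarith [hz.1])
    have h3 : ∀ᶠ p : ℝ × ℝ in 𝓝 (ρ, 1 - ρ * z), 1 - p.1 < p.2 :=
      ContinuousAt.eventually_lt (by fun_prop) (by fun_prop) (by nlinarith [hz.2])
    filter_upwards [hpre, hev _, h2, h3] with p hp hp1 hp2 hp3
    have h4 := mul_gaussMap_of_half_lt hp1
    have h5 : 0 < p.1 := by linarith [hp1.1]
    rw [mem_preimage, skewProd, fiberMap_of_gt h5.ne' (by linarith [hp1.2]) (by linarith),
      gaussMap_of_half_lt hp1, Int.fract_eq_self.2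
        ⟨div_nonneg (by linarith) h5.le, (div_lt_one h5).2 (by linarith)⟩]
    exact hp
  · have hcont : ContinuousAt (fun p : ℝ × ℝ => (1 / p.1 - 1, -p.2)) (ρ, -z) := by
      have h2 : (ρ, -z).1 ≠ 0 := hρ0.ne'
      fun_prop (disch := assumption)
    have hval : (1 / ρ - 1, - -z) = (r, z) := by rw [hρr, neg_neg]
    have hpre := hcont.preimage_mem_nhds (t := U) (by simpa only [hval] using hU)
    have h2 : ∀ᶠ p : ℝ × ℝ in 𝓝 (ρ, -z), p.2 < 0 :=
      continuousAt_snd.eventually_lt_const (by linarith [hz.1])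
    filter_upwards [hpre, hev _, h2] with p hp hp1 hp2
    rw [mem_preimage, skewProd, fiberMap_of_neg (by linarith [hp1.1]) hp2, gaussMap_of_half_lt hp1]
    exact hp

/-- Every open set meeting the interior of the rectangle is entered at a fixed time from
neighborhoods of two points of a common fiber, one in each half. -/
theorem exists_entrance {U : Set (ℝ × ℝ)} (hU : IsOpen U)
    (hne : (U ∩ Ioo (0 : ℝ) 1 ×ˢ Ioo (-1 : ℝ) 1).Nonempty) :
    ∃ m : ℕ, ∃ r ∈ Ioo (0 : ℝ) 1, ∃ z₁ ∈ Ioo (0 : ℝ) 1, ∃ z₂ ∈ Ioo (-1 : ℝ) 0,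
      skewProd^[m] ⁻¹' U ∈ 𝓝 (r, z₁) ∧ skewProd^[m] ⁻¹' U ∈ 𝓝 (r, z₂) := by
  obtain ⟨⟨r, z⟩, hrz, hr, hz, hz0⟩ : ∃ p ∈ U, p.1 ∈ Ioo (0 : ℝ) 1 ∧ p.2 ∈ Ioo (-1 : ℝ) 1 ∧
      p.2 ≠ 0 := by
    have hd : Dense {p : ℝ × ℝ | p.2 ≠ 0} := (dense_compl_singleton (0 : ℝ)).preimage isOpenMap_snd
    obtain ⟨p, hp, hp0⟩ := hd.inter_open_nonempty _
      (hU.inter (isOpen_Ioo.prod isOpen_Ioo)) hne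
    exact ⟨p, hp.1, hp.2.1, hp.2.2, hp0⟩
  rcases hz0.lt_or_gt with hneg | hpos
  · obtain ⟨r', hr', z', hz', hV⟩ := exists_skewProd_mem_of_neg (hU.mem_nhds hrz) hr ⟨hz.1, hneg⟩
    exact ⟨2, exists_skewProd_mem_of_pos hV hr' hz'⟩
  · exact ⟨1, exists_skewProd_mem_of_pos (hU.mem_nhds hrz) hr ⟨hpos, hz.2⟩⟩

/-- Over a recurrent base point, almost every nonsingular fiber orbit enters each open set meeting
the interior of the rectangle. -/
theorem volume_fiber_avoid {ρ : ℝ} (hρ : ρ ∈ gaussRecurrent) {U : Set (ℝ × ℝ)} (hU : IsOpen U)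
    (hne : (U ∩ Ioo (0 : ℝ) 1 ×ˢ Ioo (-1 : ℝ) 1).Nonempty) :
    volume {α : ℝ | α ∈ Ioo (0 : ℝ) 1 ∧ α ∉ singularFiber ρ ∧
      ∀ m, skewProd^[m] (ρ, α) ∉ U} = 0 := by
  obtain ⟨hirr, h01, hrec⟩ := hρ
  obtain ⟨m, r, hr, z₁, hz₁, z₂, hz₂, hn₁, hn₂⟩ := exists_entrance hU hne
  obtain ⟨ε₁, hε₁, hb₁⟩ := Metric.mem_nhds_iff.1
    (inter_mem hn₁ (prod_mem_nhds (isOpen_Ioo.mem_nhds hr) (isOpen_Ioo.mem_nhds hz₁)))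
  obtain ⟨ε₂, hε₂, hb₂⟩ := Metric.mem_nhds_iff.1
    (inter_mem hn₂ (prod_mem_nhds (isOpen_Ioo.mem_nhds hr) (isOpen_Ioo.mem_nhds hz₂)))
  obtain ⟨η, hη, hη₁, hη₂⟩ : ∃ η > 0, η ≤ ε₁ ∧ η ≤ ε₂ :=
    ⟨min ε₁ ε₂, lt_min hε₁ hε₂, min_le_left _ _, min_le_right _ _⟩
  have hcell : ∀ e : ℝ, e = 0 ∨ e = -1 → ∃ γ : ℝ, ∀ p β : ℝ, |p - r| < η → |β - γ| < η →
      p ∈ Ioo (0 : ℝ) 1 ∧ β ∈ Ioo e (e + 1) ∧ skewProd^[m] (p, β) ∈ U := by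
    rintro e (rfl | rfl)
    · refine ⟨z₁, fun p β hp hβ => ?_⟩
      have := hb₁ (show (p, β) ∈ Metric.ball (r, z₁) ε₁ from
        max_lt (hp.trans_le hη₁) (hβ.trans_le hη₁))
      exact ⟨this.2.1, by simpa using this.2.2, this.1⟩
    · refine ⟨z₂, fun p β hp hβ => ?_⟩
      have := hb₂ (show (p, β) ∈ Metric.ball (r, z₂) ε₂ from
        max_lt (hp.trans_le hη₂) (hβ.trans_le hη₂))
      exact ⟨this.2.1, by simpa using this.2.2, this.1⟩
  obtain ⟨s, hs₁, hs₂⟩ := exists_rat_btwn (show r - η / 2 < r by linarith)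
  obtain ⟨t, ht₁, ht₂⟩ := exists_rat_btwn (show r < r + η / 2 by linarith)
  have hst01 : 0 ≤ (s : ℝ) ∧ (t : ℝ) ≤ 1 := by
    obtain ⟨γ, hγ⟩ := hcell 0 (Or.inl rfl)
    have hγ0 : |γ - γ| < η := by simpa using hη
    exact ⟨(hγ s γ (abs_lt.2 ⟨by linarith, by linarith⟩) hγ0).1.1.le,
      (hγ t γ (abs_lt.2 ⟨by linarith, by linarith⟩) hγ0).1.2.le⟩
  refine volume_eq_zero_of_porous (c := 2 * η) (by linarith) ?_
  rintro α ⟨hα, hns, -⟩ ε hε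
  have hlim : Tendsto (fun n : ℕ => 4 / 3 * (3 / 4 : ℝ) ^ n) atTop (𝓝 (4 / 3 * 0)) :=
    (tendsto_pow_atTop_nhds_zero_of_lt_one (by norm_num) (by norm_num)).const_mul _
  rw [mul_zero] at hlim
  obtain ⟨N, hN⟩ := eventually_atTop.1 (hlim.eventually_lt_const hε)
  obtain ⟨n, hn, hnmem⟩ := hrec s t hst01.1 (by exact_mod_cast hs₂.trans ht₁) hst01.2 N
  obtain ⟨a, b, e, he, hmem, hab, hbr⟩ := exists_fiber_inverse_branch hirr h01 hα hns n
  have hapos : 0 < |a| := by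
    rcases he with ⟨-, he⟩ | ⟨-, he⟩ <;> rw [he] <;> exact gaussProd_pos hirr h01 _
  have haε : |a| < ε := by
    rcases he with ⟨-, he⟩ | ⟨-, he⟩ <;> rw [he]
    · exact (gaussProd_le hirr h01 _).trans_lt (hN _ hn)
    · exact (gaussProd_le hirr h01 _).trans_lt (hN _ (by omega))
  obtain ⟨γ, hγ⟩ := hcell e (by tauto)
  have hball : ∀ β ∈ Ioo e (e + 1),
      a * β + b ∈ Metric.closedBall (a * (e + 1 / 2) + b) (|a| / 2) := by
    intro β hβ
    have h1 : a * β + b - (a * (e + 1 / 2) + b) = a * (β - (e + 1 / 2)) := by ring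
    have h2 : |β - (e + 1 / 2)| ≤ 1 / 2 := abs_le.2 ⟨by linarith [hβ.1], by linarith [hβ.2]⟩
    rw [Metric.mem_closedBall, Real.dist_eq, h1, abs_mul]
    nlinarith
  have hhole : ∀ y ∈ Ioo (a * γ + b - |a| * η) (a * γ + b + |a| * η),
      ∃ β : ℝ, |β - γ| < η ∧ a * β + b = y := by
    intro y hy
    have ha0 : a ≠ 0 := abs_pos.1 hapos
    have h1 : (y - b) / a - γ = (y - (a * γ + b)) / a := by field_simp; ring
    refine ⟨(y - b) / a, ?_, by field_simp; ring⟩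
    rw [h1, abs_div, div_lt_iff₀ hapos, abs_lt]
    exact ⟨by linarith [hy.1], by linarith [hy.2]⟩
  have hnr : |gaussMap^[n] ρ - r| < η :=
    abs_lt.2 ⟨by linarith [hnmem.1], by linarith [hnmem.2]⟩
  refine ⟨a * (e + 1 / 2) + b, |a| / 2, a * γ + b - |a| * η, a * γ + b + |a| * η,
    by linarith, by linarith, hab ▸ hball _ hmem, ?_, ?_, by linarith⟩
  · intro y hy
    obtain ⟨β, hβ, rfl⟩ := hhole y hy
    exact hball β (hγ _ _ hnr hβ).2.1
  · rw [Set.disjoint_left]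
    rintro y ⟨-, -, hav⟩ hy
    obtain ⟨β, hβ, rfl⟩ := hhole y hy
    obtain ⟨-, h1, h2⟩ := hγ _ _ hnr hβ
    refine hav (m + n) ?_
    rw [Function.iterate_add_apply, (hbr β h1).2]
    exact h2

/-- At a nonsingular point, entering an open set is an open condition in the fiber. -/
theorem eventually_fiber_visit {ρ α : ℝ} (h : Irrational ρ) (h01 : ρ ∈ Ioo (0 : ℝ) 1)
    (hα : α ∈ Ioo (0 : ℝ) 1) (hns : α ∉ singularFiber ρ) {U : Set (ℝ × ℝ)} (hU : IsOpen U)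
    {m : ℕ} (hm : skewProd^[m] (ρ, α) ∈ U) :
    ∀ᶠ α' in 𝓝 α, skewProd^[m] (ρ, α') ∈ U := by
  obtain ⟨a, b, e, he, hmem, hab, hbr⟩ := exists_fiber_inverse_branch h h01 hα hns m
  have ha0 : a ≠ 0 := abs_pos.1 <| by
    rcases he with ⟨-, he⟩ | ⟨-, he⟩ <;> rw [he] <;> exact gaussProd_pos h h01 _
  set x := (skewProd^[m] (ρ, α)).2
  have hx : (α - b) / a = x := by rw [hab]; field_simp; ring
  have hcont : ContinuousAt (fun y : ℝ => (y - b) / a) α := by fun_prop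
  have hval : skewProd^[m] (ρ, α) = (gaussMap^[m] ρ, x) :=
    Prod.ext (skewProd_iterate_fst _ _) rfl
  have h1 : ∀ᶠ y in 𝓝 α, (y - b) / a ∈ Ioo e (e + 1) :=
    hcont.eventually_mem (isOpen_Ioo.mem_nhds (hx.symm ▸ hmem))
  have h2 : ∀ᶠ y in 𝓝 α, (gaussMap^[m] ρ, (y - b) / a) ∈ U := by
    refine (continuousAt_const.prodMk hcont).eventually_mem (hU.mem_nhds ?_)
    rw [hx, ← hval]
    exact hm
  filter_upwards [h1, h2] with y hy1 hy2
  have hy : a * ((y - b) / a) + b = y := by field_simp; ring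
  rw [← hy, (hbr _ hy1).2]
  exact hy2

/-- An invariant probability measure of a map all of whose orbits are dense has no atoms. -/
theorem noAtoms_of_dense_orbits {X : Type*} [TopologicalSpace X] [T1Space X] [Infinite X]
    [MeasurableSpace X] [MeasurableSingletonClass X] {f : X → X} {μ : Measure X}
    [IsFiniteMeasure μ] (hf : AEMeasurable f μ) (hμ : μ.map f = μ)
    (hd : ∀ x : X, Dense (range fun n : ℕ => f^[n] x)) : NullSingletonClass μ := by
  refine ⟨fun p => ?_⟩
  by_contra hp
  have hmono : ∀ n : ℕ, μ {p} ≤ μ {f^[n] p} := by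
    intro n
    induction n with
    | zero => exact le_rfl
    | succ n ih =>
      refine ih.trans ?_
      conv_rhs => rw [← hμ, Measure.map_apply_of_aemeasurable hf (measurableSet_singleton _)]
      refine measure_mono ?_
      rintro _ rfl
      exact (Function.iterate_succ_apply' f n p).symm
  have hfin : {z : X | μ {p} ≤ μ {z}}.Finite :=
    Measure.finite_const_le_meas_of_disjoint_iUnion μ (pos_iff_ne_zero.2 hp)
      (fun z => measurableSet_singleton z) (fun a b hab => by simpa using hab)
      (measure_ne_top _ _)
  have hrange : (range fun n : ℕ => f^[n] p).Finite :=
    hfin.subset (range_subset_iff.2 hmono)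
  have huniv := hrange.isClosed.closure_eq ▸ (hd p).closure_eq
  exact infinite_univ (huniv ▸ hrange)

/-- An invariant probability measure of a map all of whose orbits are dense has full support. -/
theorem isOpenPosMeasure_of_dense_orbits {X : Type*} [TopologicalSpace X] [MeasurableSpace X]
    {f : X → X} {μ : Measure X} [NeZero μ] (hf : AEMeasurable f μ) (hμ : μ.map f = μ)
    (hd : ∀ x : X, Dense (range fun n : ℕ => f^[n] x)) : μ.IsOpenPosMeasure := by
  refine ⟨fun U hU hne h0 => ?_⟩
  have hnull : ∀ n : ℕ, μ (f^[n] ⁻¹' U) = 0 := by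
    intro n
    induction n with
    | zero => exact h0
    | succ n ih =>
      rw [Function.iterate_succ, preimage_comp]
      exact Measure.preimage_null_of_map_null hf (hμ.symm ▸ ih)
  refine NeZero.ne μ (Measure.measure_univ_eq_zero.1 ?_)
  refine measure_mono_null (fun x _ => ?_) (measure_iUnion_null hnull)
  obtain ⟨_, hz, n, rfl⟩ := (hd x).inter_open_nonempty U hU hne
  exact mem_iUnion.2 ⟨n, hz⟩

/-- The probability integral transform: an atomless law is pushed to the uniform law by its
distribution function. -/
theorem map_cdf_eq_uniform (ν : Measure ℝ) [IsProbabilityMeasure ν] [NullSingletonClass ν] :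
    Continuous (ProbabilityTheory.cdf ν) ∧
      ν.map (ProbabilityTheory.cdf ν) = volume.restrict (Icc 0 1) := by
  set F := ProbabilityTheory.cdf ν with hF
  have hmono : Monotone F := ProbabilityTheory.monotone_cdf ν
  have hcont : Continuous F := by
    rw [continuous_iff_continuousAt]
    intro x
    have h1 : F.measure {x} = 0 := by
      rw [hF, ProbabilityTheory.measure_cdf]
      exact measure_singleton x
    rw [F.measure_singleton, ENNReal.ofReal_eq_zero] at h1
    rw [hmono.continuousAt_iff_leftLim_eq_rightLim, F.rightLim_eq]
    exact le_antisymm (hmono.leftLim_le le_rfl) (by linarith)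
  refine ⟨hcont, ?_⟩
  have : IsFiniteMeasure (ν.map F) := Measure.isFiniteMeasure_map _ _
  refine Measure.ext_of_Iic _ _ fun c => ?_
  rw [Measure.map_apply hcont.measurable measurableSet_Iic,
    Measure.restrict_apply measurableSet_Iic]
  have hFν : ∀ t, ν (Iic t) = ENNReal.ofReal (F t) := fun t =>
    (ProbabilityTheory.ofReal_cdf ν t).symm
  rcases lt_or_ge c 0 with hc | hc
  · have h1 : F ⁻¹' Iic c = ∅ := eq_empty_of_forall_notMem fun t ht =>
      (hc.trans_le (ProbabilityTheory.cdf_nonneg ν t)).not_ge ht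
    have h2 : Iic c ∩ Icc (0 : ℝ) 1 = ∅ := eq_empty_of_forall_notMem fun t ht =>
      (hc.trans_le ht.2.1).not_ge ht.1
    rw [h1, h2, measure_empty, measure_empty]
  rcases le_or_gt 1 c with hc1 | hc1
  · have h1 : F ⁻¹' Iic c = univ :=
      eq_univ_of_forall fun t => (ProbabilityTheory.cdf_le_one ν t).trans hc1
    have h2 : Iic c ∩ Icc (0 : ℝ) 1 = Icc 0 1 :=
      inter_eq_self_of_subset_right fun t ht => ht.2.trans hc1
    rw [h1, h2, measure_univ, Real.volume_Icc, sub_zero, ENNReal.ofReal_one]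
  have h2 : Iic c ∩ Icc (0 : ℝ) 1 = Icc 0 c := by
    ext t
    exact ⟨fun ht => ⟨ht.2.1, ht.1⟩, fun ht => ⟨ht.2, ht.1, ht.2.trans hc1.le⟩⟩
  rw [h2, Real.volume_Icc, sub_zero]
  rcases (F ⁻¹' Iic c).eq_empty_or_nonempty with hempty | hne
  · have hc0 : c ≤ 0 := by
      by_contra! hpos
      obtain ⟨t, ht⟩ := ((ProbabilityTheory.tendsto_cdf_atBot ν).eventually_lt_const hpos).exists
      exact eq_empty_iff_forall_notMem.1 hempty t ht.le
    rw [hempty, measure_empty, ENNReal.ofReal_of_nonpos hc0]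
  obtain ⟨s, hs⟩ := ((ProbabilityTheory.tendsto_cdf_atTop ν).eventually_const_lt hc1).exists
  have hbdd : BddAbove (F ⁻¹' Iic c) := ⟨s, fun t ht => by
    by_contra! hlt
    exact (hs.trans_le (hmono hlt.le)).not_ge ht⟩
  set t := sSup (F ⁻¹' Iic c)
  have ht : F t ≤ c := (isClosed_Iic.preimage hcont).csSup_mem hne hbdd
  have heq : F ⁻¹' Iic c = Iic t := by
    ext u
    exact ⟨fun hu => le_csSup hbdd hu, fun hu => (hmono hu).trans ht⟩
  have htc : F t = c := by
    refine ht.antisymm (not_lt.1 fun hlt => ?_)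
    obtain ⟨u, hu, hut⟩ := ((hcont.continuousAt.eventually_lt_const hlt).filter_mono
      (nhdsWithin_le_nhds (s := Ioi t)) |>.and self_mem_nhdsWithin).exists
    exact (le_csSup hbdd hu.le).not_gt hut
  rw [heq, hFν, htc]

theorem coe_arcLen (x y : S1) : ((arcLen x y : ℝ) : S1) = y - x :=
  AddCircle.coe_equivIco

theorem arcLen_mem (x y : S1) : arcLen x y ∈ Ico (0 : ℝ) 1 := by
  simpa [arcLen] using (AddCircle.equivIco 1 0 (y - x)).2

theorem arcLen_add_coe (x : S1) {t : ℝ} (ht : t ∈ Ico (0 : ℝ) 1) : arcLen x (x + (t : S1)) = t := by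
  rw [arcLen, add_sub_cancel_left]
  exact AddCircle.equivIco_coe_of_mem (by simpa using ht)

theorem arcLen_injective (x : S1) : Function.Injective (arcLen x) := by
  intro y z h
  simpa [coe_arcLen] using congrArg ((↑) : ℝ → S1) h

theorem continuousAt_arcLen {x y : S1} (h : y ≠ x) : ContinuousAt (arcLen x) y := by
  have h0 : y - x ≠ ((0 : ℝ) : S1) := by simpa [sub_eq_zero] using h
  exact continuousAt_subtype_val.comp (ContinuousAt.comp (f := fun y : S1 => y - x)
    (AddCircle.continuousAt_equivIco 1 0 h0) (by fun_prop))

theorem measurable_arcLen (x : S1) : Measurable (arcLen x) :=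
  measurable_subtype_coe.comp
    ((AddCircle.measurableEquivIco 1 0).measurable.comp (measurable_id.sub_const x))

theorem posArc_eq_preimage (x y : S1) : posArc x y = arcLen x ⁻¹' Ioo 0 (arcLen x y) := by
  ext z
  constructor
  · rintro ⟨t, ht, rfl⟩
    rwa [mem_preimage, arcLen_add_coe x ⟨ht.1.le, ht.2.trans (arcLen_mem x y).2⟩]
  · exact fun hz => ⟨arcLen x z, hz, by simp [coe_arcLen]⟩

/-- For an atomless probability measure on the circle, the measure of the arc from `x` to `y`
depends continuously on `y ≠ x` and is uniformly distributed. -/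
theorem measure_posArc_uniform (μ : Measure S1) [IsProbabilityMeasure μ] [NullSingletonClass μ]
    (x : S1) :
    (∀ y ≠ x, ContinuousAt (fun y => (μ (posArc x y)).toReal) y) ∧
      ∀ N : Set ℝ, volume N = 0 → μ {y | 1 - (μ (posArc x y)).toReal ∈ N} = 0 := by
  set ν := μ.map (arcLen x) with hν
  have hmeas := measurable_arcLen x
  have : IsProbabilityMeasure ν := Measure.isProbabilityMeasure_map hmeas.aemeasurable
  have : NullSingletonClass ν := by
    refine ⟨fun t => ?_⟩
    rw [hν, Measure.map_apply hmeas (measurableSet_singleton t)]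
    exact (subsingleton_singleton.preimage (arcLen_injective x)).measure_zero _
  obtain ⟨hcont, hmap⟩ := map_cdf_eq_uniform ν
  have harc : ∀ y, (μ (posArc x y)).toReal = ProbabilityTheory.cdf ν (arcLen x y) := by
    intro y
    rw [ProbabilityTheory.cdf_eq_real, measureReal_def]
    congr 1
    rw [posArc_eq_preimage, ← Measure.map_apply hmeas measurableSet_Ioo, ← hν]
    have h1 : ν (Iic 0) = 0 := by
      refine measure_mono_null (t := {0} ∪ Iio 0) ?_ ?_
      · intro t ht
        rcases (mem_Iic.1 ht).eq_or_lt with h | h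
        · exact Or.inl h
        · exact Or.inr h
      refine measure_union_null (measure_singleton _) ?_
      rw [hν, Measure.map_apply hmeas measurableSet_Iio]
      refine measure_mono_null (t := ∅) ?_ measure_empty
      exact fun z hz => absurd (arcLen_mem x z).1 (not_le.2 hz)
    refine le_antisymm (measure_mono fun t ht => ht.2.le) ?_
    calc ν (Iic (arcLen x y)) ≤ ν (Iic 0 ∪ Ioc 0 (arcLen x y)) := measure_mono fun t ht => by
          rcases le_or_gt t 0 with h | h
          · exact Or.inl h
          · exact Or.inr ⟨h, ht⟩
      _ ≤ ν (Iic 0) + ν (Ioc 0 (arcLen x y)) := measure_union_le _ _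
      _ = ν (Ioo 0 (arcLen x y)) := by rw [h1, zero_add, measure_congr Ioo_ae_eq_Ioc]
  refine ⟨fun y hy => ?_, fun N hN => ?_⟩
  · simp only [harc]
    exact hcont.continuousAt.comp (continuousAt_arcLen hy)
  · have h1 : volume ((fun t : ℝ => 1 - t) ⁻¹' N) = 0 :=
      (Measure.measurePreserving_sub_left volume (1 : ℝ)).quasiMeasurePreserving.preimage_null hN
    have h2 : ν.map (ProbabilityTheory.cdf ν) ((fun t : ℝ => 1 - t) ⁻¹' N) = 0 := by
      rw [hmap]
      exact Measure.restrict_le_self.absolutelyContinuous h1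
    have h3 := Measure.preimage_null_of_map_null hmeas.aemeasurable
      (Measure.preimage_null_of_map_null hcont.measurable.aemeasurable h2)
    simp only [harc]
    exact h3

/-- To be dense in the rectangle it suffices to meet the basic open sets that meet its interior. -/
theorem rect_subset_closure {A : Set (ℝ × ℝ)}
    (h : ∀ U ∈ TopologicalSpace.countableBasis (ℝ × ℝ),
      (U ∩ Ioo (0 : ℝ) 1 ×ˢ Ioo (-1 : ℝ) 1).Nonempty → (U ∩ A).Nonempty) :
    Rect ⊆ closure A := by
  have h1 : Rect = closure (Ioo (0 : ℝ) 1 ×ˢ Ioo (-1 : ℝ) 1) := by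
    rw [closure_prod_eq, closure_Ioo zero_ne_one, closure_Ioo (by norm_num)]
    rfl
  rw [h1]
  refine closure_minimal (fun p hp => ?_) isClosed_closure
  rw [(TopologicalSpace.isBasis_countableBasis (ℝ × ℝ)).mem_closure_iff]
  exact fun U hU hpU => h U hU ⟨p, hpU, hp⟩

/-- **Theorem 2.9 (renormalization trails are typically dense).** There is a full-measure set
`R ⊆ [0,1]` of irrationals such that for every minimal circle homeomorphism `f` with
`ρ(f) ∈ R`, unique invariant measure `μ`, and every `x ∈ S¹`, the set `B_x` of points `y` whose
renormalization trail `(Tⁿ(ρ, 1-μ(A(x,y))))ₙ` is dense in `[0,1]×[-1,1]` contains a residual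
subset of `S¹` and has full `μ`-measure. -/
theorem trailsDense :
    ∃ R0 : Set ℝ, R0 ⊆ Icc (0 : ℝ) 1 ∧ (∀ ρ ∈ R0, Irrational ρ) ∧
      volume (Icc (0 : ℝ) 1 \ R0) = 0 ∧
      ∀ (f : S1 → S1) (ρ : ℝ), IsCircleHomeo f → HasRotNum f ρ → ρ ∈ R0 →
        (∀ x : S1, Dense (Set.range fun n : ℕ => f^[n] x)) →
        ∀ μ : Measure S1, IsProbabilityMeasure μ → μ.map f = μ →
        ∀ x : S1,
          {y : S1 | Rect ⊆ closure (Set.range fun n : ℕ =>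
              skewProd^[n] (ρ, 1 - (μ (posArc x y)).toReal))} ∈ residual S1 ∧
          μ {y : S1 | Rect ⊆ closure (Set.range fun n : ℕ =>
              skewProd^[n] (ρ, 1 - (μ (posArc x y)).toReal))} = 1 := by
  refine ⟨gaussRecurrent, fun ρ hρ => Ioo_subset_Icc_self hρ.2.1, fun ρ hρ => hρ.1,
    volume_diff_gaussRecurrent, ?_⟩
  intro f ρ _ _ hρ hd μ hprob hμ x
  have hf : AEMeasurable f μ := AEMeasurable.of_map_ne_zero (hμ.symm ▸ NeZero.ne μ)
  have : Infinite S1 := by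
    have : Infinite (Ico (0 : ℝ) (0 + 1)) := (Ico_infinite (by norm_num)).to_subtype
    exact (AddCircle.equivIco (1 : ℝ) 0).infinite_iff.2 this
  have : NullSingletonClass μ := noAtoms_of_dense_orbits hf hμ hd
  have : μ.IsOpenPosMeasure := isOpenPosMeasure_of_dense_orbits hf hμ hd
  obtain ⟨hcont, hnull⟩ := measure_posArc_uniform μ x
  set α : S1 → ℝ := fun y => 1 - (μ (posArc x y)).toReal with hα
  set V : Set (ℝ × ℝ) → Set S1 := fun U => {y | ∃ m, skewProd^[m] (ρ, α y) ∈ U} with hV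
  set 𝓤 : Set (Set (ℝ × ℝ)) := {U ∈ TopologicalSpace.countableBasis (ℝ × ℝ) |
    (U ∩ Ioo (0 : ℝ) 1 ×ˢ Ioo (-1 : ℝ) 1).Nonempty} with h𝓤
  have h𝓤count : 𝓤.Countable := (TopologicalSpace.countable_countableBasis _).mono (sep_subset _ _)
  have hsub : ⋂ U ∈ 𝓤, V U ⊆ {y : S1 | Rect ⊆ closure (Set.range fun n : ℕ =>
      skewProd^[n] (ρ, 1 - (μ (posArc x y)).toReal))} := by
    intro y hy
    refine rect_subset_closure fun U hU hne => ?_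
    obtain ⟨m, hm⟩ := mem_iInter₂.1 hy U ⟨hU, hne⟩
    exact ⟨_, hm, m, rfl⟩
  have hrange : ∀ᵐ y ∂μ, α y ∈ Ioo (0 : ℝ) 1 := by
    filter_upwards [measure_eq_zero_iff_ae_notMem.1 (hnull {0, 1} ((toFinite _).measure_zero _))]
      with y hy
    have h1 : (μ (posArc x y)).toReal ≤ 1 := measureReal_le_one
    have h2 : 0 ≤ (μ (posArc x y)).toReal := ENNReal.toReal_nonneg
    simp only [mem_insert_iff, mem_singleton_iff, not_or] at hy
    exact ⟨lt_of_le_of_ne (sub_nonneg.2 h1) (Ne.symm hy.1),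
      lt_of_le_of_ne (sub_le_self _ h2) hy.2⟩
  have hns : ∀ᵐ y ∂μ, α y ∉ singularFiber ρ :=
    measure_eq_zero_iff_ae_notMem.1 (hnull _ ((countable_singularFiber hρ.1).measure_zero _))
  have hne : ∀ᵐ y ∂μ, y ≠ x := measure_eq_zero_iff_ae_notMem.1 (measure_singleton x)
  have hint : ∀ U ∈ 𝓤, ∀ᵐ y ∂μ, y ∈ interior (V U) := by
    rintro U ⟨hU, hUne⟩
    have hUo := TopologicalSpace.isOpen_of_mem_countableBasis hU
    filter_upwards [hrange, hns, hne, measure_eq_zero_iff_ae_notMem.1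
      (hnull _ (volume_fiber_avoid hρ hUo hUne))] with y hy1 hy2 hy3 hy4
    obtain ⟨m, hm⟩ : ∃ m, skewProd^[m] (ρ, α y) ∈ U := by
      by_contra! hcon
      exact hy4 ⟨hy1, hy2, hcon⟩
    have hcy : ContinuousAt α y := (hcont y hy3).const_sub 1
    rw [mem_interior_iff_mem_nhds]
    filter_upwards [hcy.eventually (eventually_fiber_visit hρ.1 hρ.2.1 hy1 hy2 hUo hm)] with z hz
    exact ⟨m, hz⟩
  constructor
  · refine mem_of_superset ((countable_bInter_mem h𝓤count).2 fun U hU => ?_) hsub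
    refine mem_of_superset (residual_of_dense_open isOpen_interior ?_) interior_subset
    exact Measure.dense_of_ae (hint U hU)
  · have hae : ∀ᵐ y ∂μ, y ∈ ⋂ U ∈ 𝓤, V U := by
      simp only [mem_iInter]
      exact (ae_ball_iff h𝓤count).2 fun U hU => (hint U hU).mono fun y hy => interior_subset hy
    exact (measure_congr (eventuallyEq_univ.2 (hae.mono fun y hy => hsub hy))).trans measure_univ
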